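/- If w, c are continuous and positive on an open set U ⊂ ℝ, then α_opt is continuous at every point of U, and the set U ∩ Ω(α_opt) contains no isolated points. -/

import Mathlib

open MeasureTheory intervalIntegral Real Set Filter Topology

noncomputable def Kker (T δ ηb t r : ℝ) : ℝ :=
  if r < t then (1 - Real.exp (-(ηb + δ) * T))⁻¹ else (Real.exp ((ηb + δ) * T) - 1)⁻¹

noncomputable def Sfun (T δ ηb : ℝ) (c α : ℝ → ℝ) (t : ℝ) : ℝ :=
  Real.exp (-(α t) - δ * t) * ∫ r in (0:ℝ)..T, Kker T δ ηb t r * c r * Real.exp (α r + δ * r)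

noncomputable def Phi (T δ ηb : ℝ) (c w α : ℝ → ℝ) : ℝ :=
  ∫ t in (0:ℝ)..T, w t * Sfun T δ ηb c α t

def MemM (T ηb : ℝ) (α : ℝ → ℝ) : Prop :=
  Monotone α ∧ (∀ t, ContinuousWithinAt α (Set.Ici t) t) ∧ α 0 = 0 ∧
    (∀ t, α (t + T) = α t + α T) ∧ α T = T * ηb

noncomputable def hfun (T δ ηb : ℝ) (c w α : ℝ → ℝ) (t : ℝ) : ℝ :=
  w t * Real.exp (-(α t) - δ * t) *
      (∫ r in (0:ℝ)..T, Kker T δ ηb t r * c r * Real.exp (α r + δ * r)) -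
    c t * Real.exp (α t + δ * t) *
      (∫ r in (0:ℝ)..T, Kker T δ ηb r t * w r * Real.exp (-(α r) - δ * r))

noncomputable def psi (T δ ηb : ℝ) (c w α : ℝ → ℝ) (t : ℝ) : ℝ :=
  - ∫ s in (0:ℝ)..t, hfun T δ ηb c w α s

def SuppM (α : ℝ → ℝ) : Set ℝ := {t | ∀ ε > 0, 0 < α (t + ε) - α (t - ε)}

def IsOpt (T δ ηb : ℝ) (c w α : ℝ → ℝ) : Prop :=
  MemM T ηb α ∧ ∀ β, MemM T ηb β → Phi T δ ηb c w α ≤ Phi T δ ηb c w β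

lemma K_bounds {T δ ηb : ℝ} (hT : 0 < T) (hδ : 0 < δ) (hη : 0 < ηb) :
    0 < (Real.exp ((ηb + δ) * T) - 1)⁻¹ ∧
    (1 - Real.exp (-(ηb + δ) * T))⁻¹ = Real.exp ((ηb + δ) * T) * (Real.exp ((ηb + δ) * T) - 1)⁻¹ ∧
    (Real.exp ((ηb + δ) * T) - 1)⁻¹ ≤ (1 - Real.exp (-(ηb + δ) * T))⁻¹ := by
  have h1 : 1 < Real.exp ((ηb + δ) * T) := by
    rw [Real.one_lt_exp_iff]; positivity
  have e : -(ηb + δ) * T = -((ηb + δ) * T) := by ring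
  have h2 : (1 - Real.exp (-(ηb + δ) * T))⁻¹ =
      Real.exp ((ηb + δ) * T) * (Real.exp ((ηb + δ) * T) - 1)⁻¹ := by
    rw [e, Real.exp_neg]
    have : Real.exp ((ηb + δ) * T) - 1 ≠ 0 := by linarith
    have h3 : 1 - (Real.exp ((ηb + δ) * T))⁻¹ = (Real.exp ((ηb + δ) * T) - 1) / Real.exp ((ηb + δ) * T) := by
      field_simp
    rw [h3, inv_div, div_eq_mul_inv]
  have h0 : 0 < (Real.exp ((ηb + δ) * T) - 1)⁻¹ := by
    apply inv_pos.2; linarith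
  refine ⟨h0, h2, ?_⟩
  rw [h2]
  nlinarith

lemma K_le {T δ ηb : ℝ} (hT : 0 < T) (hδ : 0 < δ) (hη : 0 < ηb) (t r : ℝ) :
    ‖Kker T δ ηb t r‖ ≤ (1 - Real.exp (-(ηb + δ) * T))⁻¹ := by
  obtain ⟨h0, h1, h2⟩ := K_bounds hT hδ hη
  unfold Kker
  split_ifs
  · rw [Real.norm_of_nonneg]; linarith
  · rw [Real.norm_of_nonneg]
    · exact h2
    · exact h0.le

lemma le_K {T δ ηb : ℝ} (hT : 0 < T) (hδ : 0 < δ) (hη : 0 < ηb) (t r : ℝ) :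
    (Real.exp ((ηb + δ) * T) - 1)⁻¹ ≤ Kker T δ ηb t r := by
  obtain ⟨h0, h1, h2⟩ := K_bounds hT hδ hη
  unfold Kker
  split_ifs
  · exact h2
  · exact le_rfl

lemma K_meas (T δ ηb : ℝ) : Measurable (fun p : ℝ × ℝ => Kker T δ ηb p.1 p.2) := by
  unfold Kker
  exact Measurable.ite (measurableSet_lt measurable_snd measurable_fst) measurable_const measurable_const

lemma K_intL {T δ ηb : ℝ} (hT : 0 < T) (hδ : 0 < δ) (hη : 0 < ηb) (t : ℝ) {f : ℝ → ℝ} {μ : Measure ℝ}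
    (hf : Integrable f μ) : Integrable (fun r => Kker T δ ηb t r * f r) μ :=
  hf.bdd_mul (c := (1 - Real.exp (-(ηb + δ) * T))⁻¹)
    ((K_meas T δ ηb).comp measurable_prodMk_left).aestronglyMeasurable
    (Eventually.of_forall fun r => K_le hT hδ hη t r)

lemma K_intR {T δ ηb : ℝ} (hT : 0 < T) (hδ : 0 < δ) (hη : 0 < ηb) (t : ℝ) {f : ℝ → ℝ} {μ : Measure ℝ}
    (hf : Integrable f μ) : Integrable (fun r => Kker T δ ηb r t * f r) μ :=
  hf.bdd_mul (c := (1 - Real.exp (-(ηb + δ) * T))⁻¹)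
    ((K_meas T δ ηb).comp measurable_prodMk_right).aestronglyMeasurable
    (Eventually.of_forall fun r => K_le hT hδ hη r t)

lemma K_contL {T δ ηb : ℝ} {t r : ℝ} (h : r ≠ t) : ContinuousAt (fun t => Kker T δ ηb t r) t := by
  unfold Kker
  rcases lt_or_gt_of_ne h with h | h
  · apply ContinuousAt.congr (f := fun _ => (1 - Real.exp (-(ηb + δ) * T))⁻¹) continuousAt_const
    filter_upwards [lt_mem_nhds h] with x hx
    simp [hx]
  · apply ContinuousAt.congr (f := fun _ => (Real.exp ((ηb + δ) * T) - 1)⁻¹) continuousAt_const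
    filter_upwards [gt_mem_nhds h] with x hx
    simp [not_lt.2 hx.le]

lemma K_contR {T δ ηb : ℝ} {t r : ℝ} (h : r ≠ t) : ContinuousAt (fun t => Kker T δ ηb r t) t := by
  unfold Kker
  rcases lt_or_gt_of_ne h with h | h
  · apply ContinuousAt.congr (f := fun _ => (Real.exp ((ηb + δ) * T) - 1)⁻¹) continuousAt_const
    filter_upwards [lt_mem_nhds h] with x hx
    simp [not_lt.2 hx.le]
  · apply ContinuousAt.congr (f := fun _ => (1 - Real.exp (-(ηb + δ) * T))⁻¹) continuousAt_const
    filter_upwards [gt_mem_nhds h] with x hx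
    simp [hx]

lemma ae_ne_restr (s : Set ℝ) (t : ℝ) : ∀ᵐ r ∂(volume.restrict s), r ≠ t := by
  apply ae_restrict_of_ae
  exact (Set.countable_singleton t).ae_notMem volume

lemma P_cont {T δ ηb : ℝ} (hT : 0 < T) (hδ : 0 < δ) (hη : 0 < ηb) {f : ℝ → ℝ} {s : Set ℝ}
    (hf : Integrable f (volume.restrict s)) (t : ℝ) :
    ContinuousAt (fun t => ∫ r in s, Kker T δ ηb t r * f r) t := by
  apply continuousAt_of_dominated (bound := fun r => (1 - Real.exp (-(ηb + δ) * T))⁻¹ * ‖f r‖)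
  · exact Eventually.of_forall fun x => (K_intL hT hδ hη x hf).aestronglyMeasurable
  · refine Eventually.of_forall fun x => Eventually.of_forall fun r => ?_
    rw [norm_mul]
    exact mul_le_mul_of_nonneg_right (K_le hT hδ hη _ _) (norm_nonneg _)
  · exact hf.norm.const_mul _
  · filter_upwards [ae_ne_restr s t] with r hr
    exact (K_contL hr).mul continuousAt_const

lemma Q_cont {T δ ηb : ℝ} (hT : 0 < T) (hδ : 0 < δ) (hη : 0 < ηb) {f : ℝ → ℝ} {s : Set ℝ}
    (hf : Integrable f (volume.restrict s)) (t : ℝ) :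
    ContinuousAt (fun t => ∫ r in s, Kker T δ ηb r t * f r) t := by
  apply continuousAt_of_dominated (bound := fun r => (1 - Real.exp (-(ηb + δ) * T))⁻¹ * ‖f r‖)
  · exact Eventually.of_forall fun x => (K_intR hT hδ hη x hf).aestronglyMeasurable
  · refine Eventually.of_forall fun x => Eventually.of_forall fun r => ?_
    rw [norm_mul]
    exact mul_le_mul_of_nonneg_right (K_le hT hδ hη _ _) (norm_nonneg _)
  · exact hf.norm.const_mul _
  · filter_upwards [ae_ne_restr s t] with r hr
    exact (K_contR hr).mul continuousAt_const

lemma P_wrap {T δ ηb : ℝ} (hT : 0 < T) (hδ : 0 < δ) (hη : 0 < ηb) (f : ℝ → ℝ) :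
    (∫ r in Ioc 0 T, Kker T δ ηb T r * f r) =
      Real.exp ((ηb + δ) * T) * ∫ r in Ioc 0 T, Kker T δ ηb 0 r * f r := by
  rw [← MeasureTheory.integral_const_mul]
  apply MeasureTheory.integral_congr_ae
  filter_upwards [ae_ne_restr (Ioc 0 T) T, ae_restrict_mem measurableSet_Ioc] with r hr hr2
  have h1 : r < T := lt_of_le_of_ne hr2.2 hr
  have h2 : ¬ r < 0 := not_lt.2 hr2.1.le
  simp only [Kker, h1, h2, if_true, if_false]
  rw [(K_bounds hT hδ hη).2.1]; ring

lemma Q_wrap {T δ ηb : ℝ} (hT : 0 < T) (hδ : 0 < δ) (hη : 0 < ηb) (f : ℝ → ℝ) :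
    (∫ r in Ioc 0 T, Kker T δ ηb r 0 * f r) =
      Real.exp ((ηb + δ) * T) * ∫ r in Ioc 0 T, Kker T δ ηb r T * f r := by
  rw [← MeasureTheory.integral_const_mul]
  apply MeasureTheory.integral_congr_ae
  filter_upwards [ae_ne_restr (Ioc 0 T) T, ae_restrict_mem measurableSet_Ioc] with r hr hr2
  have h1 : ¬ T < r := not_lt.2 hr2.2
  have h2 : 0 < r := hr2.1
  simp only [Kker, h1, h2, if_true, if_false]
  rw [(K_bounds hT hδ hη).2.1]; ring

lemma f_int {T δ : ℝ} (hδ : 0 < δ) {c α : ℝ → ℝ} (hα : Monotone α)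
    (hcI : IntegrableOn c (Set.Icc 0 T)) :
    Integrable (fun r => c r * Real.exp (α r + δ * r)) (volume.restrict (Ioc 0 T)) := by
  have := hcI.mono_set Ioc_subset_Icc_self
  refine Integrable.mul_bdd (c := Real.exp (α T + δ * T)) this ?_ ?_
  · exact (Real.measurable_exp.comp (hα.measurable.add (measurable_id.const_mul δ))).aestronglyMeasurable
  · filter_upwards [ae_restrict_mem measurableSet_Ioc] with r hr
    rw [Real.norm_of_nonneg (Real.exp_pos _).le]
    apply Real.exp_le_exp.2
    have := hα hr.2
    nlinarith [hr.2]

lemma g_int {T δ : ℝ} (hδ : 0 < δ) {w α : ℝ → ℝ} (hα : Monotone α)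
    (hwI : IntegrableOn w (Set.Icc 0 T)) :
    Integrable (fun r => w r * Real.exp (-(α r) - δ * r)) (volume.restrict (Ioc 0 T)) := by
  have := hwI.mono_set Ioc_subset_Icc_self
  refine Integrable.mul_bdd (c := Real.exp (-(α 0))) this ?_ ?_
  · exact (Real.measurable_exp.comp (hα.measurable.neg.sub (measurable_id.const_mul δ))).aestronglyMeasurable
  · filter_upwards [ae_restrict_mem measurableSet_Ioc] with r hr
    rw [Real.norm_of_nonneg (Real.exp_pos _).le]
    apply Real.exp_le_exp.2
    have := hα hr.1.le
    nlinarith [hr.1]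

noncomputable def Bf (T δ ηb : ℝ) (g f : ℝ → ℝ) : ℝ :=
  ∫ p : ℝ × ℝ, Kker T δ ηb p.1 p.2 * (g p.1 * f p.2)
    ∂((volume.restrict (Ioc 0 T)).prod (volume.restrict (Ioc 0 T)))

lemma Bf_int {T δ ηb : ℝ} (hT : 0 < T) (hδ : 0 < δ) (hη : 0 < ηb) {g f : ℝ → ℝ}
    (hg : Integrable g (volume.restrict (Ioc 0 T))) (hf : Integrable f (volume.restrict (Ioc 0 T))) :
    Integrable (fun p : ℝ × ℝ => Kker T δ ηb p.1 p.2 * (g p.1 * f p.2))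
      ((volume.restrict (Ioc 0 T)).prod (volume.restrict (Ioc 0 T))) :=
  (hg.mul_prod hf).bdd_mul (c := (1 - Real.exp (-(ηb + δ) * T))⁻¹)
    (K_meas T δ ηb).aestronglyMeasurable
    (Eventually.of_forall fun _ => K_le hT hδ hη _ _)

lemma Bf_eqL {T δ ηb : ℝ} (hT : 0 < T) (hδ : 0 < δ) (hη : 0 < ηb) {g f : ℝ → ℝ}
    (hg : Integrable g (volume.restrict (Ioc 0 T))) (hf : Integrable f (volume.restrict (Ioc 0 T))) :
    Bf T δ ηb g f = ∫ t in Ioc 0 T, g t * ∫ r in Ioc 0 T, Kker T δ ηb t r * f r := by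
  rw [Bf, integral_prod _ (Bf_int hT hδ hη hg hf)]
  congr 1; ext t
  rw [← MeasureTheory.integral_const_mul]
  congr 1; ext r
  simp only
  ring

lemma Bf_eqR {T δ ηb : ℝ} (hT : 0 < T) (hδ : 0 < δ) (hη : 0 < ηb) {g f : ℝ → ℝ}
    (hg : Integrable g (volume.restrict (Ioc 0 T))) (hf : Integrable f (volume.restrict (Ioc 0 T))) :
    Bf T δ ηb g f = ∫ t in Ioc 0 T, f t * ∫ r in Ioc 0 T, Kker T δ ηb r t * g r := by
  rw [Bf, integral_prod_symm _ (Bf_int hT hδ hη hg hf)]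
  congr 1; ext t
  rw [← MeasureTheory.integral_const_mul]
  congr 1; ext r
  simp only
  ring

lemma Bf_expand {T δ ηb : ℝ} (hT : 0 < T) (hδ : 0 < δ) (hη : 0 < ηb) {g f g1 f1 : ℝ → ℝ}
    (hg : Integrable g (volume.restrict (Ioc 0 T))) (hf : Integrable f (volume.restrict (Ioc 0 T)))
    (hg1 : Integrable g1 (volume.restrict (Ioc 0 T))) (hf1 : Integrable f1 (volume.restrict (Ioc 0 T)))
    (x y : ℝ) :
    Bf T δ ηb (fun t => g t + x * g1 t) (fun t => f t + y * f1 t) =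
      Bf T δ ηb g f + x * Bf T δ ηb g1 f + y * Bf T δ ηb g f1 + x * y * Bf T δ ηb g1 f1 := by
  have h1 := Bf_int hT hδ hη hg hf
  have h2 := (Bf_int hT hδ hη hg1 hf).const_mul x
  have h3 := (Bf_int hT hδ hη hg hf1).const_mul y
  have h4 := (Bf_int hT hδ hη hg1 hf1).const_mul (x * y)
  have h12 : Integrable (fun p : ℝ × ℝ => Kker T δ ηb p.1 p.2 * (g p.1 * f p.2) +
      x * (Kker T δ ηb p.1 p.2 * (g1 p.1 * f p.2)))
      ((volume.restrict (Ioc 0 T)).prod (volume.restrict (Ioc 0 T))) := h1.add h2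
  have h123 : Integrable (fun p : ℝ × ℝ => Kker T δ ηb p.1 p.2 * (g p.1 * f p.2) +
      x * (Kker T δ ηb p.1 p.2 * (g1 p.1 * f p.2)) + y * (Kker T δ ηb p.1 p.2 * (g p.1 * f1 p.2)))
      ((volume.restrict (Ioc 0 T)).prod (volume.restrict (Ioc 0 T))) := h12.add h3
  simp only [Bf]
  rw [← MeasureTheory.integral_const_mul, ← MeasureTheory.integral_const_mul,
    ← MeasureTheory.integral_const_mul, ← MeasureTheory.integral_add h1 h2,
    ← MeasureTheory.integral_add h12 h3, ← MeasureTheory.integral_add h123 h4]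
  congr 1; ext p
  ring

lemma Bf_congr {T δ ηb : ℝ} {g f g2 f2 : ℝ → ℝ}
    (h : ∀ t ∈ Ioo 0 T, ∀ r ∈ Ioo 0 T, g t * f r = g2 t * f2 r) :
    Bf T δ ηb g f = Bf T δ ηb g2 f2 := by
  have h0 : ∀ᵐ t ∂(volume.restrict (Ioc 0 T)), t ∈ Ioo 0 T := by
    filter_upwards [ae_ne_restr (Ioc 0 T) T, ae_restrict_mem measurableSet_Ioc] with r hr hr2
    exact ⟨hr2.1, lt_of_le_of_ne hr2.2 hr⟩
  apply MeasureTheory.integral_congr_ae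
  filter_upwards [Measure.quasiMeasurePreserving_fst.ae h0, Measure.quasiMeasurePreserving_snd.ae h0]
    with p hp1 hp2
  rw [h _ hp1 _ hp2]

lemma Phi_eq {T δ ηb : ℝ} (hT : 0 < T) (hδ : 0 < δ) (hη : 0 < ηb) {c w α : ℝ → ℝ} (hα : Monotone α)
    (hcI : IntegrableOn c (Set.Icc 0 T)) (hwI : IntegrableOn w (Set.Icc 0 T)) :
    Phi T δ ηb c w α = Bf T δ ηb (fun r => w r * Real.exp (-(α r) - δ * r))
      (fun r => c r * Real.exp (α r + δ * r)) := by
  rw [Bf_eqL hT hδ hη (g_int hδ hα hwI) (f_int hδ hα hcI), Phi, integral_of_le hT.le]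
  congr 1; ext t
  rw [Sfun, integral_of_le hT.le]
  simp only [mul_assoc]

lemma gP_int {T δ ηb : ℝ} (hT : 0 < T) (hδ : 0 < δ) (hη : 0 < ηb) {g f : ℝ → ℝ}
    (hg : Integrable g (volume.restrict (Ioc 0 T))) (hf : Integrable f (volume.restrict (Ioc 0 T))) :
    Integrable (fun t => g t * ∫ r in Ioc 0 T, Kker T δ ηb t r * f r) (volume.restrict (Ioc 0 T)) := by
  refine (Bf_int hT hδ hη hg hf).integral_prod_left.congr (Eventually.of_forall fun t => ?_)
  simp only
  rw [← MeasureTheory.integral_const_mul]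
  congr 1; ext r
  ring

lemma fQ_int {T δ ηb : ℝ} (hT : 0 < T) (hδ : 0 < δ) (hη : 0 < ηb) {g f : ℝ → ℝ}
    (hg : Integrable g (volume.restrict (Ioc 0 T))) (hf : Integrable f (volume.restrict (Ioc 0 T))) :
    Integrable (fun t => f t * ∫ r in Ioc 0 T, Kker T δ ηb r t * g r) (volume.restrict (Ioc 0 T)) := by
  refine (Bf_int hT hδ hη hg hf).integral_prod_right.congr (Eventually.of_forall fun t => ?_)
  simp only
  rw [← MeasureTheory.integral_const_mul]
  congr 1; ext r
  ring

lemma hfun_eq {T δ ηb : ℝ} (hT : 0 < T) (c w α : ℝ → ℝ) (t : ℝ) :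
    hfun T δ ηb c w α t =
    w t * Real.exp (-(α t) - δ * t) *
      (∫ r in Ioc 0 T, Kker T δ ηb t r * (c r * Real.exp (α r + δ * r))) -
    c t * Real.exp (α t + δ * t) *
      (∫ r in Ioc 0 T, Kker T δ ηb r t * (w r * Real.exp (-(α r) - δ * r))) := by
  rw [hfun, integral_of_le hT.le, integral_of_le hT.le]
  simp only [mul_assoc]

lemma FV {T δ ηb : ℝ} (hT : 0 < T) (hδ : 0 < δ) (hη : 0 < ηb) {c w α ind : ℝ → ℝ} {σ J k0 a b : ℝ}
    (hσ : σ = 1 ∨ σ = -1) (hα : Monotone α) (hJ : 0 < J) (ha : 0 ≤ a) (hab : a < b) (hb : b ≤ T)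
    (hcI : IntegrableOn c (Set.Icc 0 T)) (hwI : IntegrableOn w (Set.Icc 0 T))
    (hind : ∀ t ∈ Ioo 0 T, ind t = if t ∈ Ico a b then 1 else 0)
    (hs : ∀ s ∈ Ioc 0 J, Monotone (fun t => α t + σ * s * (ind t - k0)) ∧
      Phi T δ ηb c w α ≤ Phi T δ ηb c w (fun t => α t + σ * s * (ind t - k0))) :
    ∃ t ∈ Ioo a b, σ * hfun T δ ηb c w α t ≤ 0 := by
  set f : ℝ → ℝ := fun r => c r * Real.exp (α r + δ * r) with hfd
  set g : ℝ → ℝ := fun r => w r * Real.exp (-(α r) - δ * r) with hgd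
  have hf : Integrable f (volume.restrict (Ioc 0 T)) := f_int hδ hα hcI
  have hg : Integrable g (volume.restrict (Ioc 0 T)) := g_int hδ hα hwI
  set f1 := (Ico a b).indicator f with hf1d
  set g1 := (Ico a b).indicator g with hg1d
  have hf1 : Integrable f1 (volume.restrict (Ioc 0 T)) := hf.indicator measurableSet_Ico
  have hg1 : Integrable g1 (volume.restrict (Ioc 0 T)) := hg.indicator measurableSet_Ico
  set X := Bf T δ ηb g1 f with hX
  set Y := Bf T δ ηb g f1 with hY
  set Z := Bf T δ ηb g1 f1 with hZ
  have key : ∀ s ∈ Ioc 0 J, 0 ≤ σ * (-X + Real.exp (σ * s) * Y - (Real.exp (σ * s) - 1) * Z) := by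
    intro s hsm
    obtain ⟨hm, hle⟩ := hs s hsm
    set q := Real.exp (σ * s) with hq
    have hqp : 0 < q := Real.exp_pos _
    rw [Phi_eq hT hδ hη hα hcI hwI, Phi_eq hT hδ hη hm hcI hwI,
      Bf_congr (g := fun r => w r * Real.exp (-(α r + σ * s * (ind r - k0)) - δ * r))
        (f := fun r => c r * Real.exp (α r + σ * s * (ind r - k0) + δ * r)) (g2 := fun t => g t + (q⁻¹ - 1) * g1 t) (f2 := fun t => f t + (q - 1) * f1 t),
      Bf_expand hT hδ hη hg hf hg1 hf1] at hle
    · have h1 : 0 ≤ (q⁻¹ - 1) * X + (q - 1) * Y + (q⁻¹ - 1) * (q - 1) * Z := by linarith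
      have h2 : (q - 1) * (-X + q * Y - (q - 1) * Z) =
          q * ((q⁻¹ - 1) * X + (q - 1) * Y + (q⁻¹ - 1) * (q - 1) * Z) := by
        field_simp; ring
      have h3 : 0 ≤ (q - 1) * (-X + q * Y - (q - 1) * Z) := by
        rw [h2]; positivity
      rcases hσ with rfl | rfl
      · have : 1 < q := by rw [hq, Real.one_lt_exp_iff]; linarith [hsm.1]
        have := nonneg_of_mul_nonneg_right h3 (by linarith)
        linarith
      · have : q < 1 := by rw [hq, Real.exp_lt_one_iff]; linarith [hsm.1]
        have := nonpos_of_mul_nonneg_right h3 (by linarith)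
        linarith
    · have haux : ∀ t ∈ Ioo 0 T, ∀ v : ℝ, (v + (q - 1) * (if t ∈ Ico a b then v else 0)) =
          v * Real.exp (σ * s * ind t) ∧ (v + (q⁻¹ - 1) * (if t ∈ Ico a b then v else 0)) =
          v * Real.exp (-(σ * s * ind t)) := by
        intro t ht v
        rw [hind t ht]
        split_ifs
        · rw [mul_one, Real.exp_neg, ← hq]; constructor <;> ring
        · simp
      intro t ht r hr
      simp only [hf1d, hg1d, Set.indicator_apply]
      rw [(haux t ht _).2, (haux r hr _).1]
      simp only [hfd, hgd]
      have e1 : Real.exp (-(α t + σ * s * (ind t - k0)) - δ * t) =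
        Real.exp (-(α t) - δ * t) * Real.exp (-(σ * s * ind t)) * Real.exp (σ * s * k0) := by
        rw [← Real.exp_add, ← Real.exp_add]; congr 1; ring
      have e2 : Real.exp (α r + σ * s * (ind r - k0) + δ * r) =
        Real.exp (α r + δ * r) * Real.exp (σ * s * ind r) * (Real.exp (σ * s * k0))⁻¹ := by
        rw [← Real.exp_neg, ← Real.exp_add, ← Real.exp_add]; congr 1; ring
      rw [e1, e2]
      have := (Real.exp_pos (σ * s * k0)).ne'
      field_simp
  have hlim : 0 ≤ σ * (Y - X) := by
    have ht : Tendsto (fun s : ℝ => σ * (-X + Real.exp (σ * s) * Y - (Real.exp (σ * s) - 1) * Z))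
        (𝓝[>] 0) (𝓝 (σ * (Y - X))) := by
      have : Continuous (fun s : ℝ => σ * (-X + Real.exp (σ * s) * Y - (Real.exp (σ * s) - 1) * Z)) := by
        fun_prop
      have h := (this.tendsto 0).mono_left (nhdsWithin_le_nhds (s := Ioi 0))
      convert h using 2
      simp
      ring_nf
      simp
    apply ge_of_tendsto ht
    filter_upwards [Ioc_mem_nhdsGT hJ] with s hs
    exact key s hs
  by_contra hcon
  push Not at hcon
  have hXY : X - Y = ∫ t in Ioc 0 T, (Ico a b).indicator (hfun T δ ηb c w α) t := by
    rw [hX, hY, Bf_eqL hT hδ hη hg1 hf, Bf_eqR hT hδ hη hg hf1,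
      ← MeasureTheory.integral_sub (gP_int hT hδ hη hg1 hf) (fQ_int hT hδ hη hg hf1)]
    congr 1; ext t
    simp only [hf1d, hg1d, Set.indicator_apply, hfun_eq hT]
    split_ifs <;> simp [hfd, hgd]
  have hint : Integrable (fun t => σ * (Ico a b).indicator (hfun T δ ηb c w α) t)
      (volume.restrict (Ioc 0 T)) := by
    refine Integrable.const_mul ?_ _
    refine ((gP_int hT hδ hη hg1 hf).sub (fQ_int hT hδ hη hg hf1)).congr
      (Eventually.of_forall fun t => ?_)
    simp only [Pi.sub_apply, hf1d, hg1d, Set.indicator_apply, hfun_eq hT]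
    split_ifs <;> simp [hfd, hgd]
  have hpos : 0 < ∫ t in Ioc 0 T, σ * (Ico a b).indicator (hfun T δ ηb c w α) t := by
    rw [integral_pos_iff_support_of_nonneg_ae _ hint]
    · have hsub : Ioo a b ⊆ Function.support (fun t => σ * (Ico a b).indicator (hfun T δ ηb c w α) t) := by
        intro t ht
        rw [Function.mem_support, Set.indicator_of_mem (Ioo_subset_Ico_self ht)]
        exact (hcon t ht).ne'
      refine lt_of_lt_of_le ?_ (measure_mono hsub)
      rw [Measure.restrict_apply measurableSet_Ioo, Set.inter_eq_left.2]
      · rw [Real.volume_Ioo]; simpa using hab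
      · intro t ht
        exact ⟨lt_of_le_of_lt ha ht.1, (ht.2.trans_le hb).le⟩
    · filter_upwards [ae_ne_restr (Ioc 0 T) a] with t ht
      simp only [Pi.zero_apply, Set.indicator_apply]
      split_ifs with h
      · exact (hcon t ⟨lt_of_le_of_ne h.1 ht.symm, h.2⟩).le
      · simp
  rw [MeasureTheory.integral_const_mul, ← hXY] at hpos
  linarith

noncomputable def indp (T a b t : ℝ) : ℝ := if t - ⌊t / T⌋ * T ∈ Ico a b then 1 else 0

lemma indp_of {T a b x : ℝ} (hT : 0 < T) (n : ℤ) (h1 : n * T ≤ x) (h2 : x < n * T + T) :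
    indp T a b x = if x - n * T ∈ Ico a b then 1 else 0 := by
  have : ⌊x / T⌋ = n := by
    rw [Int.floor_eq_iff]
    constructor
    · rwa [le_div_iff₀ hT]
    · rw [div_lt_iff₀ hT]; linarith
  rw [indp, this]

lemma fl_bd {T : ℝ} (hT : 0 < T) (x : ℝ) : (⌊x / T⌋ : ℝ) * T ≤ x ∧ x < ⌊x / T⌋ * T + T := by
  constructor
  · rw [← le_div_iff₀ hT]; exact Int.floor_le _
  · have := Int.lt_floor_add_one (x / T)
    rw [div_lt_iff₀ hT] at this; linarith

lemma indp_add {T a b : ℝ} (hT : 0 < T) (x : ℝ) : indp T a b (x + T) = indp T a b x := by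
  obtain ⟨h1, h2⟩ := fl_bd hT x
  rw [indp_of hT (⌊x / T⌋ + 1) (by push_cast; linarith) (by push_cast; linarith), indp]
  have : x + T - ((⌊x / T⌋ + 1 : ℤ) : ℝ) * T = x - ⌊x / T⌋ * T := by push_cast; ring
  rw [this]

lemma indp_rc {T a b : ℝ} (hT : 0 < T) (x : ℝ) : ContinuousWithinAt (indp T a b) (Ici x) x := by
  obtain ⟨h1, h2⟩ := fl_bd hT x
  set n := ⌊x / T⌋ with hn
  apply ContinuousWithinAt.congr_of_eventuallyEq (f := fun _ => indp T a b x) continuousWithinAt_const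
  · rw [indp_of hT n h1 h2]
    by_cases hx : x - n * T ∈ Ico a b
    · filter_upwards [self_mem_nhdsWithin, mem_nhdsWithin_of_mem_nhds (gt_mem_nhds h2),
        mem_nhdsWithin_of_mem_nhds (gt_mem_nhds (show x < n * T + b by linarith [hx.2]))] with y hy hy2 hy3
      have hy' : x ≤ y := hy
      rw [indp_of hT n (by linarith) hy2, if_pos hx, if_pos]
      exact ⟨by linarith [hx.1], by linarith⟩
    · rw [if_neg hx]
      by_cases hxa : x - n * T < a
      · filter_upwards [self_mem_nhdsWithin, mem_nhdsWithin_of_mem_nhds (gt_mem_nhds h2),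
          mem_nhdsWithin_of_mem_nhds (gt_mem_nhds (show x < n * T + a by linarith))] with y hy hy2 hy3
        have hy' : x ≤ y := hy
        rw [indp_of hT n (by linarith) hy2, if_neg]
        intro h; linarith [h.1]
      · have hxb : b ≤ x - n * T := by
          by_contra hh; exact hx ⟨not_lt.1 hxa, not_le.1 hh⟩
        filter_upwards [self_mem_nhdsWithin, mem_nhdsWithin_of_mem_nhds (gt_mem_nhds h2)] with y hy hy2
        have hy' : x ≤ y := hy
        rw [indp_of hT n (by linarith) hy2, if_neg]
        intro h; linarith [h.2]
  · rfl

lemma al_shift {T : ℝ} {α : ℝ → ℝ} (h : ∀ t, α (t + T) = α t + α T) (n : ℤ) (x : ℝ) :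
    α (x + n * T) = α x + n * α T := by
  induction n using Int.induction_on with
  | zero => simp
  | succ i ih =>
    have := h (x + i * T)
    push_cast at ih ⊢
    rw [show x + ((i : ℝ) + 1) * T = x + i * T + T by ring, this, ih]; ring
  | pred i ih =>
    have := h (x + (-i - 1) * T)
    push_cast at ih ⊢
    rw [show x + (-(i : ℝ) - 1) * T + T = x + -i * T by ring, ih] at this
    linarith

lemma mem_pert {T ηb a b κ : ℝ} {α : ℝ → ℝ} (hT : 0 < T) (hα : MemM T ηb α)
    (hm : ∀ x y, x ≤ y → κ * (indp T a b x - indp T a b y) ≤ α y - α x) :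
    MemM T ηb (fun t => α t + κ * (indp T a b t - indp T a b 0)) := by
  obtain ⟨h1, h2, h3, h4, h5⟩ := hα
  have hT0 : indp T a b T = indp T a b 0 := by
    have := indp_add (a := a) (b := b) hT 0
    rwa [zero_add] at this
  refine ⟨?_, ?_, ?_, ?_, ?_⟩
  · intro x y hxy
    have := hm x y hxy
    simp only
    linarith
  · intro t
    exact (h2 t).add (((indp_rc hT t).sub continuousWithinAt_const).const_mul κ)
  · simp [h3]
  · intro t
    simp only [indp_add hT, h4 t, hT0]
    ring
  · simp [hT0, h5]

lemma indp_cases (T a b x : ℝ) : indp T a b x = 0 ∨ indp T a b x = 1 := by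
  unfold indp; split_ifs <;> simp

lemma indp_one {T a b x : ℝ} (hT : 0 < T) (h : indp T a b x = 1) :
    ∃ n : ℤ, n * T ≤ x ∧ x < n * T + T ∧ x - n * T ∈ Ico a b := by
  refine ⟨⌊x / T⌋, (fl_bd hT x).1, (fl_bd hT x).2, ?_⟩
  by_contra hh
  rw [indp, if_neg hh] at h
  simp at h

lemma indp_one_of {T a b x : ℝ} (hT : 0 < T) (ha : 0 ≤ a) (hb : b ≤ T) (n : ℤ)
    (h : x - n * T ∈ Ico a b) : indp T a b x = 1 := by
  rw [indp_of hT n (by linarith [h.1]) (by linarith [h.2]), if_pos h]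

lemma mono_right {T a b s J : ℝ} {α : ℝ → ℝ} (hT : 0 < T) (ha : 0 ≤ a) (hb : b ≤ T)
    (hα : Monotone α) (h4 : ∀ t, α (t + T) = α t + α T) (hs : 0 < s) (hsJ : s ≤ J)
    (hJ : ∀ x < a, α x ≤ α a - J) (x y : ℝ) (hxy : x ≤ y) :
    -1 * s * (indp T a b x - indp T a b y) ≤ α y - α x := by
  have hm := hα hxy
  rcases indp_cases T a b x with hx | hx <;> rcases indp_cases T a b y with hy | hy <;> rw [hx, hy]
  · linarith
  · obtain ⟨n, h1, h2, h3⟩ := indp_one hT hy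
    have hxa : x - n * T < a := by
      by_contra hh
      rw [indp_one_of hT ha hb n ⟨not_lt.1 hh, by linarith [h3.2]⟩] at hx
      simp at hx
    have e1 := al_shift h4 n (x - n * T)
    have e2 := al_shift h4 n (y - n * T)
    rw [sub_add_cancel] at e1 e2
    have := hJ _ hxa
    have := hα h3.1
    linarith
  · linarith
  · linarith

lemma mono_left {T a b s J : ℝ} {α : ℝ → ℝ} (hT : 0 < T) (ha : 0 ≤ a) (hb : b ≤ T)
    (hα : Monotone α) (h4 : ∀ t, α (t + T) = α t + α T) (hs : 0 < s) (hsJ : s ≤ J)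
    (hJ : ∀ x < b, α x ≤ α b - J) (x y : ℝ) (hxy : x ≤ y) :
    1 * s * (indp T a b x - indp T a b y) ≤ α y - α x := by
  have hm := hα hxy
  rcases indp_cases T a b x with hx | hx <;> rcases indp_cases T a b y with hy | hy <;> rw [hx, hy]
  · linarith
  · linarith
  · obtain ⟨n, h1, h2, h3⟩ := indp_one hT hx
    have hyb : b ≤ y - n * T := by
      by_contra hh
      rw [indp_one_of hT ha hb n ⟨by linarith [h3.1], not_le.1 hh⟩] at hy
      simp at hy
    have e1 := al_shift h4 n (x - n * T)
    have e2 := al_shift h4 n (y - n * T)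
    rw [sub_add_cancel] at e1 e2
    have := hJ _ h3.2
    have := hα hyb
    linarith
  · linarith

lemma indp_Ioo {T a b : ℝ} (hT : 0 < T) : ∀ t ∈ Ioo 0 T, indp T a b t = if t ∈ Ico a b then 1 else 0 := by
  intro t ht
  have := indp_of (a := a) (b := b) hT 0 (x := t) (by simpa using ht.1.le) (by simpa using ht.2)
  simpa using this

lemma core {T δ ηb : ℝ} {c w α : ℝ → ℝ} {t0 t1 J : ℝ}
    (hT : 0 < T) (hδ : 0 < δ) (hη : 0 < ηb)
    (hc0 : ∀ s, 0 ≤ c s) (hcI : IntegrableOn c (Set.Icc 0 T))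
    (hw0 : ∀ s, 0 ≤ w s) (hwI : IntegrableOn w (Set.Icc 0 T))
    (hcne : ¬ c =ᵐ[volume.restrict (Set.Icc (0:ℝ) T)] 0)
    (hopt : IsOpt T δ ηb c w α)
    (ht0 : t0 ∈ Ico 0 T) (ht1 : t1 ∈ Ioc 0 T) (ht : t1 = t0 ∨ (t0 = 0 ∧ t1 = T))
    (hct : c t1 = c t0) (hwt : w t1 = w t0)
    (cc0 : ContinuousAt c t0) (cc1 : ContinuousAt c t1)
    (cw0 : ContinuousAt w t0) (cw1 : ContinuousAt w t1)
    (hwpos : 0 < w t0)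
    (hJ : 0 < J) (hJ0 : ∀ x < t0, α x ≤ α t0 - J) (hJ1 : ∀ x < t1, α x ≤ α t1 - J)
    (hlim : Tendsto α (𝓝[<] t1) (𝓝 (α t1 - J))) : False := by
  obtain ⟨hmem, hmin⟩ := hopt
  obtain ⟨hα, hrc, h00, h4, h5⟩ := id hmem
  set f : ℝ → ℝ := fun r => c r * Real.exp (α r + δ * r) with hfd
  set g : ℝ → ℝ := fun r => w r * Real.exp (-(α r) - δ * r) with hgd
  have hf : Integrable f (volume.restrict (Ioc 0 T)) := f_int hδ hα hcI
  have hg : Integrable g (volume.restrict (Ioc 0 T)) := g_int hδ hα hwI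
  set P : ℝ → ℝ := fun t => ∫ r in Ioc 0 T, Kker T δ ηb t r * f r with hPd
  set Q : ℝ → ℝ := fun t => ∫ r in Ioc 0 T, Kker T δ ηb r t * g r with hQd
  have hPc : ∀ t, ContinuousAt P t := P_cont hT hδ hη hf
  have hQc : ∀ t, ContinuousAt Q t := Q_cont hT hδ hη hg
  have hK0 := (K_bounds hT hδ hη).1
  have hh : ∀ t, hfun T δ ηb c w α t = w t * Real.exp (-(α t) - δ * t) * P t -
    c t * Real.exp (α t + δ * t) * Q t := fun t => hfun_eq hT c w α t
  have hf0 : ∀ r, 0 ≤ f r := fun r => mul_nonneg (hc0 r) (Real.exp_pos _).le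
  have hg0 : ∀ r, 0 ≤ g r := fun r => mul_nonneg (hw0 r) (Real.exp_pos _).le
  have hQ0 : 0 ≤ Q t0 := by
    apply MeasureTheory.integral_nonneg
    intro r
    exact mul_nonneg (hK0.le.trans (le_K hT hδ hη _ _)) (hg0 r)
  have hP0 : 0 < P t0 := by
    have hC : 0 < ∫ r in Ioc 0 T, f r := by
      have h1 : 0 ≤ ∫ r in Ioc 0 T, f r := MeasureTheory.integral_nonneg hf0
      refine lt_of_le_of_ne h1 fun h => hcne ?_
      have h2 := (integral_eq_zero_iff_of_nonneg hf0 hf).1 h.symm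
      rw [restrict_Ioc_eq_restrict_Icc] at h2
      filter_upwards [h2] with r hr
      have : c r * Real.exp (α r + δ * r) = 0 := hr
      simpa [(Real.exp_pos _).ne'] using this
    refine lt_of_lt_of_le (mul_pos hK0 hC) ?_
    rw [← MeasureTheory.integral_const_mul]
    apply integral_mono (hf.const_mul _) (K_intL hT hδ hη t0 hf)
    intro r
    exact mul_le_mul_of_nonneg_right (le_K hT hδ hη _ _) (hf0 r)
  have hPw : Real.exp (-(α t1) - δ * t1) * P t1 = Real.exp (-(α t0) - δ * t0) * P t0 := by
    rcases ht with rfl | ⟨rfl, rfl⟩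
    · rfl
    · have : P t1 = Real.exp ((ηb + δ) * t1) * P 0 := P_wrap hT hδ hη f
      rw [this, h00, h5, ← mul_assoc, ← Real.exp_add]
      congr 2; ring
  have hQw : Real.exp (α t1 + δ * t1) * Q t1 = Real.exp (α t0 + δ * t0) * Q t0 := by
    rcases ht with rfl | ⟨rfl, rfl⟩
    · rfl
    · have : Q 0 = Real.exp ((ηb + δ) * t1) * Q t1 := Q_wrap hT hδ hη g
      rw [this, h00, h5, ← mul_assoc, ← Real.exp_add]
      congr 2; ring
  -- right limit
  have hR : 0 ≤ hfun T δ ηb c w α t0 := by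
    by_contra hneg
    push Not at hneg
    have hcont : ContinuousWithinAt (hfun T δ ηb c w α) (Ici t0) t0 := by
      have : hfun T δ ηb c w α = fun t => w t * Real.exp (-(α t) - δ * t) * P t -
        c t * Real.exp (α t + δ * t) * Q t := funext hh
      rw [this]
      have hid : ContinuousWithinAt (fun t : ℝ => δ * t) (Ici t0) t0 := by fun_prop
      exact ((cw0.continuousWithinAt.mul (((hrc t0).neg.sub hid).rexp)).mul (hPc t0).continuousWithinAt).sub
        ((cc0.continuousWithinAt.mul (((hrc t0).add hid).rexp)).mul (hQc t0).continuousWithinAt)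
    have hev : ∀ᶠ t in 𝓝[>] t0, hfun T δ ηb c w α t < 0 :=
      (hcont.mono Ioi_subset_Ici_self).eventually_lt_const hneg
    obtain ⟨u, hu, hsub⟩ := (mem_nhdsGT_iff_exists_Ioo_subset' ht0.2).1 hev
    have hu' : t0 < u := hu
    obtain ⟨t, htm, hle⟩ := FV (ind := indp T t0 (min u T)) (σ := -1) (J := J)
      (k0 := indp T t0 (min u T) 0) (a := t0) (b := min u T) (c := c) (w := w) hT hδ hη (Or.inr rfl)
      hα hJ ht0.1 (lt_min hu' ht0.2) (min_le_right _ _) hcI hwI (indp_Ioo hT)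
      (fun s hs => by
        have := mem_pert hT hmem (mono_right hT ht0.1 (min_le_right u T) hα h4 hs.1 hs.2 hJ0)
        exact ⟨this.1, hmin _ this⟩)
    have : hfun T δ ηb c w α t < 0 := hsub ⟨htm.1, htm.2.trans_le (min_le_left _ _)⟩
    linarith
  have hL : w t1 * Real.exp (-(α t1 - J) - δ * t1) * P t1 -
      c t1 * Real.exp ((α t1 - J) + δ * t1) * Q t1 ≤ 0 := by
    by_contra hneg
    push Not at hneg
    have hcont : Tendsto (hfun T δ ηb c w α) (𝓝[<] t1)
        (𝓝 (w t1 * Real.exp (-(α t1 - J) - δ * t1) * P t1 -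
      c t1 * Real.exp ((α t1 - J) + δ * t1) * Q t1)) := by
      have : hfun T δ ηb c w α = fun t => w t * Real.exp (-(α t) - δ * t) * P t -
        c t * Real.exp (α t + δ * t) * Q t := funext hh
      rw [this]
      have hid : Tendsto (fun t : ℝ => δ * t) (𝓝[<] t1) (𝓝 (δ * t1)) := by
        have : ContinuousWithinAt (fun t : ℝ => δ * t) (Iio t1) t1 := by fun_prop
        exact this
      have a1 : Tendsto w (𝓝[<] t1) (𝓝 (w t1)) := cw1.continuousWithinAt
      have a2 : Tendsto c (𝓝[<] t1) (𝓝 (c t1)) := cc1.continuousWithinAt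
      have a3 : Tendsto P (𝓝[<] t1) (𝓝 (P t1)) := (hPc t1).continuousWithinAt
      have a4 : Tendsto Q (𝓝[<] t1) (𝓝 (Q t1)) := (hQc t1).continuousWithinAt
      exact ((a1.mul ((hlim.neg.sub hid).rexp)).mul a3).sub
        ((a2.mul ((hlim.add hid).rexp)).mul a4)
    have hev : ∀ᶠ t in 𝓝[<] t1, 0 < hfun T δ ηb c w α t := hcont.eventually_const_lt hneg
    obtain ⟨u, hu, hsub⟩ := (mem_nhdsLT_iff_exists_Ioo_subset' ht1.1).1 hev
    have hu' : u < t1 := hu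
    obtain ⟨t, htm, hle⟩ := FV (ind := indp T (max u 0) t1) (σ := 1) (J := J)
      (k0 := indp T (max u 0) t1 0) (a := max u 0) (b := t1) (c := c) (w := w) hT hδ hη (Or.inl rfl)
      hα hJ (le_max_right _ _) (max_lt hu' ht1.1) ht1.2 hcI hwI (indp_Ioo hT)
      (fun s hs => by
        have := mem_pert hT hmem (mono_left hT (le_max_right u 0) ht1.2 hα h4 hs.1 hs.2 hJ1)
        exact ⟨this.1, hmin _ this⟩)
    have : 0 < hfun T δ ηb c w α t := hsub ⟨(le_max_left _ _).trans_lt htm.1, htm.2⟩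
    linarith
  have e1 : Real.exp (-(α t1 - J) - δ * t1) = Real.exp (-(α t1) - δ * t1) * Real.exp J := by
    rw [← Real.exp_add]; congr 1; ring
  have e2 : Real.exp ((α t1 - J) + δ * t1) = Real.exp (α t1 + δ * t1) * Real.exp (-J) := by
    rw [← Real.exp_add]; congr 1; ring
  rw [hh] at hR
  have e3 : w t1 * Real.exp (-(α t1 - J) - δ * t1) * P t1 =
      Real.exp J * (w t0 * Real.exp (-(α t0) - δ * t0) * P t0) := by
    rw [e1, hwt]; linear_combination (w t0 * Real.exp J) * hPw
  have e4 : c t1 * Real.exp ((α t1 - J) + δ * t1) * Q t1 =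
      Real.exp (-J) * (c t0 * Real.exp (α t0 + δ * t0) * Q t0) := by
    rw [e2, hct]; linear_combination (c t0 * Real.exp (-J)) * hQw
  rw [e3, e4] at hL
  have p1 : 0 < w t0 * Real.exp (-(α t0) - δ * t0) * P t0 := by positivity
  have p2 : 0 ≤ c t0 * Real.exp (α t0 + δ * t0) * Q t0 :=
    mul_nonneg (mul_nonneg (hc0 _) (Real.exp_pos _).le) hQ0
  have p3 : 1 < Real.exp J := by rwa [Real.one_lt_exp_iff]
  have p4 : Real.exp (-J) ≤ 1 := by rw [Real.exp_le_one_iff]; linarith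
  nlinarith

lemma cont_shift {T : ℝ} {c : ℝ → ℝ} (hcP : ∀ s, c (s + T) = c s) (n : ℤ) {t : ℝ} :
    c (t + n * T) = c t ∧ (ContinuousAt c t → ContinuousAt c (t + n * T)) := by
  have hp : Function.Periodic c T := hcP
  have hn : ∀ x, c (x + n * T) = c x := fun x => (hp.int_mul n) x
  refine ⟨hn t, fun h => ?_⟩
  have : c = c ∘ (fun x => x - n * T) := by
    ext x
    have := hn (x - n * T)
    simp only [sub_add_cancel] at this
    simpa using this
  rw [this]
  apply ContinuousAt.comp
  · simpa using h
  · fun_prop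

lemma tend_shift {α : ℝ → ℝ} {a t L k : ℝ} (h : ∀ x, α (x + a) = α x + k)
    (hl : Tendsto α (𝓝[<] t) (𝓝 L)) : Tendsto α (𝓝[<] (t + a)) (𝓝 (L + k)) := by
  have e : α = fun x => α (x - a) + k := by
    ext x; rw [← h, sub_add_cancel]
  rw [e]
  refine Tendsto.add_const k (hl.comp ?_)
  apply tendsto_nhdsWithin_of_tendsto_nhds_of_eventually_within
  · have : ContinuousWithinAt (fun x : ℝ => x - a) (Iio (t + a)) (t + a) := by fun_prop
    simpa [ContinuousWithinAt] using this
  · filter_upwards [self_mem_nhdsWithin] with x hx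
    have : x < t + a := hx
    show x - a < t
    linarith

lemma cont_main {T δ ηb : ℝ} {c w α : ℝ → ℝ}
    (hT : 0 < T) (hδ : 0 < δ) (hη : 0 < ηb)
    (hc0 : ∀ s, 0 ≤ c s) (hcP : ∀ s, c (s + T) = c s) (hcI : IntegrableOn c (Set.Icc 0 T))
    (hw0 : ∀ s, 0 ≤ w s) (hwP : ∀ s, w (s + T) = w s) (hwI : IntegrableOn w (Set.Icc 0 T))
    (hcne : ¬ c =ᵐ[volume.restrict (Set.Icc (0:ℝ) T)] 0)
    (hopt : IsOpt T δ ηb c w α) {t : ℝ} (cc : ContinuousAt c t) (cw : ContinuousAt w t)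
    (hwpos : 0 < w t) : ContinuousAt α t := by
  obtain ⟨hα, hrc, h00, h4, h5⟩ := id hopt.1
  set J := α t - Function.leftLim α t with hJd
  have hlim : Tendsto α (𝓝[<] t) (𝓝 (α t - J)) := by
    rw [hJd, sub_sub_cancel]; exact hα.tendsto_leftLim t
  have hx : ∀ x < t, α x ≤ α t - J := fun x hx => by
    rw [hJd, sub_sub_cancel]; exact hα.le_leftLim hx
  have hJ0 : 0 ≤ J := sub_nonneg.2 (hα.leftLim_le le_rfl)
  rcases hJ0.eq_or_lt with hJ | hJ
  · rw [continuousAt_iff_continuous_left'_right']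
    refine ⟨?_, (hrc t).mono Ioi_subset_Ici_self⟩
    rw [← hJ, sub_zero] at hlim
    exact hlim
  exfalso
  have sx : ∀ n : ℤ, ∀ x < t + n * T, α x ≤ α (t + n * T) - J := by
    intro n x hxt
    have e1 := al_shift h4 n (x - n * T)
    rw [sub_add_cancel] at e1
    rw [e1, al_shift h4 n]
    have := hx (x - n * T) (by linarith)
    linarith
  have sl : ∀ n : ℤ, Tendsto α (𝓝[<] (t + n * T)) (𝓝 (α (t + n * T) - J)) := by
    intro n
    have := tend_shift (al_shift h4 n) hlim
    rw [al_shift h4 n]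
    convert this using 2
    ring
  obtain ⟨h1, h2⟩ := fl_bd hT t
  have fin : ∀ n m : ℤ, t + n * T ∈ Ico 0 T → t + m * T ∈ Ioc 0 T →
      (t + m * T = t + n * T ∨ (t + n * T = 0 ∧ t + m * T = T)) → False := by
    intro n m hn hm hnm
    refine core hT hδ hη hc0 hcI hw0 hwI hcne hopt hn hm hnm ?_ ?_ ((cont_shift hcP n).2 cc)
      ((cont_shift hcP m).2 cc) ((cont_shift hwP n).2 cw) ((cont_shift hwP m).2 cw) ?_ hJ
      (sx n) (sx m) (sl m)
    · rw [(cont_shift hcP n).1, (cont_shift hcP m).1]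
    · rw [(cont_shift hwP n).1, (cont_shift hwP m).1]
    · rw [(cont_shift hwP n).1]; exact hwpos
  set n := ⌊t / T⌋ with hn
  rcases h1.eq_or_lt with h | h
  · refine fin (-n) (-n + 1) ?_ ?_ (Or.inr ?_)
    · push_cast; constructor <;> linarith
    · push_cast; constructor <;> linarith
    · push_cast; constructor <;> linarith
  · refine fin (-n) (-n) ?_ ?_ (Or.inl rfl)
    · push_cast; constructor <;> linarith
    · push_cast; constructor <;> linarith

lemma const_of_nosupp {α : ℝ → ℝ} (hα : Monotone α) {p q : ℝ}
    (h : ∀ x ∈ Ioo p q, x ∉ SuppM α) : ∀ x ∈ Ioo p q, ∀ y ∈ Ioo p q, α x = α y := by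
  have hloc : ∀ x ∈ Ioo p q, ∀ᶠ y in 𝓝 x, α y = α x := by
    intro x hx
    have := h x hx
    simp only [SuppM, Set.mem_ofPred_eq, not_forall, not_lt] at this
    obtain ⟨ε, hε, hle⟩ := this
    filter_upwards [Ioo_mem_nhds (show x - ε < x by linarith) (show x < x + ε by linarith)] with y hy
    have a1 := hα hy.1.le
    have a2 := hα hy.2.le
    have a3 := hα (show x - ε ≤ x by linarith)
    have a4 := hα (show x ≤ x + ε by linarith)
    linarith
  have hd : ∀ x ∈ Ioo p q, HasDerivAt α 0 x := fun x hx =>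
    (hasDerivAt_const x (α x)).congr_of_eventuallyEq (hloc x hx)
  intro x hx y hy
  exact isOpen_Ioo.is_const_of_deriv_eq_zero isPreconnected_Ioo
    (fun z hz => (hd z hz).differentiableAt.differentiableWithinAt)
    (fun z hz => (hd z hz).deriv) hx hy

theorem stmt10 (T δ ηb : ℝ) (c w αopt : ℝ → ℝ) (U : Set ℝ)
    (hT : 0 < T) (hδ : 0 < δ) (hη : 0 < ηb)
    (hc0 : ∀ s, 0 ≤ c s) (hcP : ∀ s, c (s + T) = c s) (hcI : IntegrableOn c (Set.Icc 0 T))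
    (hw0 : ∀ s, 0 ≤ w s) (hwP : ∀ s, w (s + T) = w s) (hwI : IntegrableOn w (Set.Icc 0 T))
    (hcne : ¬ c =ᵐ[volume.restrict (Set.Icc (0:ℝ) T)] 0)
    (hwne : ¬ w =ᵐ[volume.restrict (Set.Icc (0:ℝ) T)] 0)
    (hpos : (∀ᵐ s ∂volume, 0 < c s) ∨ (∀ᵐ s ∂volume, 0 < w s))
    (hopt : IsOpt T δ ηb c w αopt)
    (hU : IsOpen U)
    (hcc : ContinuousOn c U) (hwc : ContinuousOn w U)
    (hcpos : ∀ t ∈ U, 0 < c t) (hwpos : ∀ t ∈ U, 0 < w t) :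
    (∀ t ∈ U, ContinuousAt αopt t) ∧
    (∀ t ∈ U ∩ SuppM αopt, t ∈ closure ((U ∩ SuppM αopt) \ {t})) := by
  have hcont : ∀ t ∈ U, ContinuousAt αopt t := fun t ht =>
    cont_main hT hδ hη hc0 hcP hcI hw0 hwP hwI hcne hopt (hcc.continuousAt (hU.mem_nhds ht))
      (hwc.continuousAt (hU.mem_nhds ht)) (hwpos t ht)
  refine ⟨hcont, ?_⟩
  rintro t ⟨htU, htS⟩
  by_contra hcl
  have hα : Monotone αopt := hopt.1.1
  have hnh : (closure ((U ∩ SuppM αopt) \ {t}))ᶜ ∩ U ∈ 𝓝 t :=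
    Filter.inter_mem (isClosed_closure.isOpen_compl.mem_nhds hcl) (hU.mem_nhds htU)
  obtain ⟨ε, hε, hball⟩ := Metric.mem_nhds_iff.1 hnh
  rw [Real.ball_eq_Ioo] at hball
  have hno : ∀ x ∈ Ioo (t - ε) (t + ε), x ≠ t → x ∉ SuppM αopt := by
    intro x hx hxt hxs
    have := hball hx
    exact this.1 (subset_closure ⟨⟨this.2, hxs⟩, hxt⟩)
  have hl := const_of_nosupp hα (p := t - ε) (q := t)
    (fun x hx => hno x ⟨hx.1, by linarith [hx.2]⟩ hx.2.ne)
  have hr := const_of_nosupp hα (p := t) (q := t + ε)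
    (fun x hx => hno x ⟨by linarith [hx.1], hx.2⟩ hx.1.ne')
  have tl : Tendsto αopt (𝓝[<] t) (𝓝 (αopt t)) := (hcont t htU).continuousWithinAt
  have tr : Tendsto αopt (𝓝[>] t) (𝓝 (αopt t)) := (hcont t htU).continuousWithinAt
  have el : αopt t = αopt (t - ε / 2) := by
    refine tendsto_nhds_unique tl (Tendsto.congr' ?_ tendsto_const_nhds)
    filter_upwards [Ioo_mem_nhdsLT (show t - ε < t by linarith)] with x hx
    exact hl _ ⟨by linarith, by linarith⟩ _ hx
  have er : αopt t = αopt (t + ε / 2) := by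
    refine tendsto_nhds_unique tr (Tendsto.congr' ?_ tendsto_const_nhds)
    filter_upwards [Ioo_mem_nhdsGT (show t < t + ε by linarith)] with x hx
    exact hr _ ⟨by linarith, by linarith⟩ _ hx
  have := htS (ε / 2) (by positivity)
  linarith
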